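/- Let X > 0 and let h : ℝ → ℝ be continuous on [0,X], strictly decreasing on [0,X], and concave on [0,X], with h(X) = 0, and set Ω := {(x,y) ∈ ℝ² : 0 ≤ x ≤ X and 0 ≤ y ≤ h(x)}. Suppose x₀ ∈ (0,X) satisfies h(x₀) = x₀ and h is differentiable at x₀, and set m := h'(x₀). Then for all integers i ≥ 1 and j ≥ 1: (1) if −(i−1) ≤ m·(j+1) (equivalently −(i−1)/(j+1) ≤ m) then ‖(i−1, j+1)‖_Ω^* ≤ ‖(i,j)‖_Ω^*; and (2) if −(i+1) ≥ m·(j−1) (equivalently, for j ≥ 2, −(i+1)/(j−1) ≥ m) then ‖(i+1, j−1)‖_Ω^* ≤ ‖(i,j)‖_Ω^*. -/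

import Mathlib

open scoped BigOperators

/-- The "dual norm" `‖v‖_Ω^* = max_{w ∈ Ω} ⟨v,w⟩` of a vector `v ∈ ℝ²`
with respect to a (nonempty compact) set `Ω ⊆ ℝ²`. -/
noncomputable def dualNorm (Ω : Set (ℝ × ℝ)) (v : ℝ × ℝ) : ℝ :=
  sSup ((fun w : ℝ × ℝ => v.1 * w.1 + v.2 * w.2) '' Ω)

/-- The dual norm of a pair of nonnegative integers. -/
noncomputable def pairNorm (Ω : Set (ℝ × ℝ)) (p : ℕ × ℕ) : ℝ :=
  dualNorm Ω ((p.1 : ℝ), (p.2 : ℝ))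

/-- Total dual norm of a finite multiset of pairs. -/
noncomputable def totalNorm (Ω : Set (ℝ × ℝ)) (P : Multiset (ℕ × ℕ)) : ℝ :=
  (P.map (pairNorm Ω)).sum

/-- `(k,ℓ)`-admissibility of a finite multiset of pairs in `ℤ_{≥0}² \ {(0,0)}`:
the index condition `Σ (i+j) + q − 1 = k` (written additively), weak permissibility,
and length at most `ℓ ∈ ℕ∞`. -/
def Admissible (k : ℕ) (ℓ : ℕ∞) (P : Multiset (ℕ × ℕ)) : Prop :=
  (∀ p ∈ P, p ≠ (0, 0)) ∧
  (P.map (fun p => p.1 + p.2)).sum + Multiset.card P = k + 1 ∧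
  (2 ≤ Multiset.card P → (∃ p ∈ P, p.1 ≠ 0) ∧ (∃ p ∈ P, p.2 ≠ 0)) ∧
  (Multiset.card P : ℕ∞) ≤ ℓ

/-- `(≥k,ℓ)`-admissibility: same as `(k,ℓ)`-admissibility with the index condition
relaxed to `Σ (i+j) + q − 1 ≥ k`. -/
def GeAdmissible (k : ℕ) (ℓ : ℕ∞) (P : Multiset (ℕ × ℕ)) : Prop :=
  (∀ p ∈ P, p ≠ (0, 0)) ∧
  k + 1 ≤ (P.map (fun p => p.1 + p.2)).sum + Multiset.card P ∧
  (2 ≤ Multiset.card P → (∃ p ∈ P, p.1 ≠ 0) ∧ (∃ p ∈ P, p.2 ≠ 0)) ∧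
  (Multiset.card P : ℕ∞) ≤ ℓ

/-- The combinatorial capacity `G_k^ℓ(Ω) = min_{P ∈ 𝒫_{k,ℓ}} Σ_{(i,j)∈P} ‖(i,j)‖_Ω^*`. -/
noncomputable def Gcap (Ω : Set (ℝ × ℝ)) (k : ℕ) (ℓ : ℕ∞) : ℝ :=
  sInf (totalNorm Ω '' {P | Admissible k ℓ P})

/-- A moment domain: a nonempty compact convex subset of the first quadrant of `ℝ²`
which is closed under coordinatewise decrease (the moment image of a 4-dimensional
convex toric domain). -/
def MomentDomain (Ω : Set (ℝ × ℝ)) : Prop :=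
  Ω.Nonempty ∧ IsCompact Ω ∧ Convex ℝ Ω ∧
  (∀ p ∈ Ω, 0 ≤ p.1 ∧ 0 ≤ p.2) ∧
  (∀ p ∈ Ω, ∀ q : ℝ × ℝ, 0 ≤ q.1 → q.1 ≤ p.1 → 0 ≤ q.2 → q.2 ≤ p.2 → q ∈ Ω)

/-- A long domain: a compact convex subset of the first quadrant containing the unit
square `[0,1] × [0,1]` and with maximal `y`-coordinate equal to `1`. -/
def LongDomain (Ω : Set (ℝ × ℝ)) : Prop :=
  IsCompact Ω ∧ Convex ℝ Ω ∧
  (∀ p ∈ Ω, 0 ≤ p.1 ∧ 0 ≤ p.2) ∧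
  Set.Icc ((0 : ℝ), (0 : ℝ)) (1, 1) ⊆ Ω ∧
  (∀ p ∈ Ω, p.2 ≤ 1)

/-- A concave function lies below its tangent lines. -/
lemma ConcaveOn.le_tangent_of_hasDerivAt {S : Set ℝ} {f : ℝ → ℝ} {f' a x : ℝ}
    (hf : ConcaveOn ℝ S f) (ha : a ∈ S) (hx : x ∈ S) (hd : HasDerivAt f f' a) :
    f x ≤ f a + f' * (x - a) := by
  rcases lt_trichotomy x a with hlt | rfl | hlt
  · have key := hf.le_slope_of_hasDerivAt hx ha hlt hd
    rw [slope_def_field, le_div_iff₀ (sub_pos.2 hlt)] at key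
    linarith
  · simp
  · have key := hf.slope_le_of_hasDerivAt ha hx hlt hd
    rw [slope_def_field, div_le_iff₀ (sub_pos.2 hlt)] at key
    linarith

lemma le_dualNorm {Ω : Set (ℝ × ℝ)} (hΩ : IsCompact Ω) (v : ℝ × ℝ) {w : ℝ × ℝ} (hw : w ∈ Ω) :
    v.1 * w.1 + v.2 * w.2 ≤ dualNorm Ω v :=
  le_csSup (hΩ.image (by fun_prop)).bddAbove ⟨w, hw, rfl⟩

lemma dualNorm_le {Ω : Set (ℝ × ℝ)} (hΩ : Ω.Nonempty) {v : ℝ × ℝ} {c : ℝ}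
    (hc : ∀ w ∈ Ω, v.1 * w.1 + v.2 * w.2 ≤ c) : dualNorm Ω v ≤ c :=
  csSup_le (hΩ.image _) (by rintro _ ⟨w, hw, rfl⟩; exact hc w hw)

/-- The region between the axis and the graph of a continuous function on a compact set is
compact. -/
lemma isCompact_subgraph {S : Set ℝ} {f : ℝ → ℝ} (hS : IsCompact S) (hf : ContinuousOn f S) :
    IsCompact {p : ℝ × ℝ | p.1 ∈ S ∧ 0 ≤ p.2 ∧ p.2 ≤ f p.1} := by
  obtain ⟨c, hc⟩ := (hS.image_of_continuousOn hf).bddAbove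
  have hK : IsCompact (S ×ˢ Set.Icc (0 : ℝ) c) := hS.prod isCompact_Icc
  have hfst : ContinuousOn (fun p : ℝ × ℝ => f p.1) (S ×ˢ Set.Icc (0 : ℝ) c) :=
    hf.comp continuousOn_fst fun p hp => hp.1
  have hclosed := hK.isClosed.isClosed_le continuousOn_snd hfst
  convert hK.of_isClosed_subset hclosed fun p hp => hp.1 using 1
  ext p
  constructor
  · rintro ⟨h1, h2, h3⟩
    exact ⟨⟨h1, h2, h3.trans (hc ⟨p.1, h1, rfl⟩)⟩, h3⟩
  · rintro ⟨⟨h1, h2, -⟩, h3⟩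
    exact ⟨h1, h2, h3⟩

/-- index-preserving moves which weakly decrease the dual norm,
for the region under the graph of a strictly decreasing concave function `h`
whose fixed point `x₀ = h(x₀)` has slope `m`. -/
theorem stmt_1 (X : ℝ) (hX : 0 < X) (h : ℝ → ℝ)
    (hcont : ContinuousOn h (Set.Icc 0 X))
    (hanti : StrictAntiOn h (Set.Icc 0 X))
    (hconc : ConcaveOn ℝ (Set.Icc 0 X) h)
    (hhX : h X = 0)
    (Ω : Set (ℝ × ℝ))
    (hΩ : Ω = {p : ℝ × ℝ | 0 ≤ p.1 ∧ p.1 ≤ X ∧ 0 ≤ p.2 ∧ p.2 ≤ h p.1})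
    (x₀ : ℝ) (hx₀ : x₀ ∈ Set.Ioo 0 X) (hfix : h x₀ = x₀)
    (m : ℝ) (hderiv : HasDerivAt h m x₀)
    (i j : ℕ) (hi : 1 ≤ i) (hj : 1 ≤ j) :
    (-((i : ℝ) - 1) ≤ m * ((j : ℝ) + 1) →
      dualNorm Ω ((i : ℝ) - 1, (j : ℝ) + 1) ≤ dualNorm Ω ((i : ℝ), (j : ℝ))) ∧
    (m * ((j : ℝ) - 1) ≤ -((i : ℝ) + 1) →
      dualNorm Ω ((i : ℝ) + 1, (j : ℝ) - 1) ≤ dualNorm Ω ((i : ℝ), (j : ℝ))) := by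
  have hx₀' : x₀ ∈ Set.Icc 0 X := Set.Ioo_subset_Icc_self hx₀
  have hmem : ((x₀, x₀) : ℝ × ℝ) ∈ Ω := by
    rw [hΩ]
    exact ⟨hx₀'.1, hx₀'.2, hx₀'.1, hfix.ge⟩
  have hcpt : IsCompact Ω := by
    rw [hΩ]
    simpa only [Set.mem_Icc, and_assoc] using isCompact_subgraph isCompact_Icc hcont
  have hsub : ∀ w ∈ Ω, w.1 ∈ Set.Icc 0 X ∧ w.2 ≤ h w.1 := by
    rw [hΩ]
    exact fun w hw => ⟨⟨hw.1, hw.2.1⟩, hw.2.2.2⟩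
  have htan : ∀ w ∈ Ω, w.2 ≤ x₀ + m * (w.1 - x₀) := fun w hw => by
    have key := hconc.le_tangent_of_hasDerivAt hx₀' (hsub w hw).1 hderiv
    linarith [(hsub w hw).2]
  have hi' : (1 : ℝ) ≤ i := by exact_mod_cast hi
  have hj' : (1 : ℝ) ≤ j := by exact_mod_cast hj
  have hdiag := le_dualNorm hcpt ((i : ℝ), (j : ℝ)) hmem
  refine ⟨fun hm => dualNorm_le ⟨_, hmem⟩ fun w hw => ?_,
    fun hm => dualNorm_le ⟨_, hmem⟩ fun w hw => ?_⟩
  all_goals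
    have hle := le_dualNorm hcpt ((i : ℝ), (j : ℝ)) hw
    have ht := htan w hw
    obtain ⟨hw1, hw2⟩ := hsub w hw
    dsimp only at hle hdiag ⊢
  · rcases le_or_gt w.2 w.1 with hyx | hxy
    · linarith
    · have hlt : w.1 < x₀ := by
        by_contra! hge
        have := hanti.antitoneOn hx₀' hw1 hge
        linarith
      have h1 := mul_le_mul_of_nonneg_left ht (by linarith : (0 : ℝ) ≤ j + 1)
      have h2 := mul_le_mul_of_nonneg_right hm (sub_pos.2 hlt).le
      linarith
  · rcases le_or_gt w.1 w.2 with hxy | hyx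
    · linarith
    · rcases le_total w.1 x₀ with hge | hle'
      · have h1 := mul_le_mul_of_nonneg_left hge (by linarith : (0 : ℝ) ≤ i + 1)
        have h2 := mul_le_mul_of_nonneg_left (hyx.le.trans hge) (by linarith : (0 : ℝ) ≤ j - 1)
        linarith
      · have h1 := mul_le_mul_of_nonneg_left ht (by linarith : (0 : ℝ) ≤ j - 1)
        have h2 := mul_le_mul_of_nonneg_right hm (sub_nonneg.2 hle')
        linarith
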